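/- The set Π of conformally inscribed parallelograms is a linear subspace of ℝ⁹ of dimension 3. More precisely, Π is closed under coordinatewise addition and scalar multiplication, and the linear map Π → ℝ³ sending P = (x_A, y_A, x_B, y_B, x_C, y_C, x_D, y_D, w) to (x_A, x_B, w) is a bijection. -/

import Mathlib

noncomputable section

open Real Set

/-- Membership predicate for conformally inscribed parallelograms.
Coordinates of `P : Fin 9 → ℝ`:
`0 = x_A, 1 = y_A, 2 = x_B, 3 = y_B, 4 = x_C, 5 = y_C, 6 = x_D, 7 = y_D, 8 = w`.
The vertex `(x_L, y_L)` lies on the line `L(w)` for `L ∈ {A,B,C,D}` and the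
midpoints of the two diagonals coincide. -/
def IsCIP (mA mB mC mD bA : ℝ) (P : Fin 9 → ℝ) : Prop :=
  P 1 = mA * P 0 + bA * P 8 ∧
  P 3 = mB * P 2 + P 8 ∧
  P 5 = mC * P 4 ∧
  P 7 = mD * P 6 ∧
  P 0 + P 4 = P 2 + P 6 ∧
  P 1 + P 5 = P 3 + P 7

/-- `Π`, the set of conformally inscribed parallelograms. -/
def CIP (mA mB mC mD bA : ℝ) : Set (Fin 9 → ℝ) := {P | IsCIP mA mB mC mD bA P}

/-- The `AC` diagonal vector of a parallelogram. -/
def vAC (P : Fin 9 → ℝ) : ℝ × ℝ := (P 0 - P 4, P 1 - P 5)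

/-- The `BD` diagonal vector of a parallelogram. -/
def vBD (P : Fin 9 → ℝ) : ℝ × ℝ := (P 2 - P 6, P 3 - P 7)

/-- The `AB` side vector of a parallelogram. -/
def vAB (P : Fin 9 → ℝ) : ℝ × ℝ := (P 0 - P 2, P 1 - P 3)

/-- The `BC` side vector of a parallelogram. -/
def vBC (P : Fin 9 → ℝ) : ℝ × ℝ := (P 2 - P 4, P 3 - P 5)

/-- Dot product in `ℝ²`. -/
def dot2 (a b : ℝ × ℝ) : ℝ := a.1 * b.1 + a.2 * b.2

/-- The inner product `⟨P, Q⟩ = P_AC · Q_AC + P_BD · Q_BD` on `Π`. -/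
def pinner (P Q : Fin 9 → ℝ) : ℝ := dot2 (vAC P) (vAC Q) + dot2 (vBD P) (vBD Q)

theorem CIP.add_mem {mA mB mC mD bA : ℝ} {P Q : Fin 9 → ℝ} (hP : P ∈ CIP mA mB mC mD bA)
    (hQ : Q ∈ CIP mA mB mC mD bA) : P + Q ∈ CIP mA mB mC mD bA := by
  obtain ⟨h1, h2, h3, h4, h5, h6⟩ := hP
  obtain ⟨k1, k2, k3, k4, k5, k6⟩ := hQ
  refine ⟨?_, ?_, ?_, ?_, ?_, ?_⟩ <;> simp only [Pi.add_apply] <;> linarith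

theorem CIP.smul_mem {mA mB mC mD bA : ℝ} (c : ℝ) {P : Fin 9 → ℝ}
    (hP : P ∈ CIP mA mB mC mD bA) : c • P ∈ CIP mA mB mC mD bA := by
  obtain ⟨h1, h2, h3, h4, h5, h6⟩ := hP
  refine ⟨?_, ?_, ?_, ?_, ?_, ?_⟩ <;> simp only [Pi.smul_apply, smul_eq_mul]
  · linear_combination c * h1
  · linear_combination c * h2
  · linear_combination c * h3
  · linear_combination c * h4
  · linear_combination c * h5
  · linear_combination c * h6

/-- `Π` as a linear subspace of `ℝ⁹`. -/
def CIP.submodule (mA mB mC mD bA : ℝ) : Submodule ℝ (Fin 9 → ℝ) where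
  carrier := CIP mA mB mC mD bA
  add_mem' := CIP.add_mem
  zero_mem' := by simp [CIP, IsCIP]
  smul_mem' c _ := CIP.smul_mem c

/-- The linear map sending a parallelogram to `(x_A, x_B, w)`. -/
def CIP.coords (mA mB mC mD bA : ℝ) : CIP.submodule mA mB mC mD bA →ₗ[ℝ] ℝ × ℝ × ℝ where
  toFun P := ((P : Fin 9 → ℝ) 0, (P : Fin 9 → ℝ) 2, (P : Fin 9 → ℝ) 8)
  map_add' _ _ := rfl
  map_smul' _ _ := rfl

theorem CIP.coords_injective {mA mB mC mD bA : ℝ} (hCD : mC ≠ mD) :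
    Function.Injective (CIP.coords mA mB mC mD bA) := by
  rintro ⟨P, h1, h2, h3, h4, h5, h6⟩ ⟨Q, k1, k2, k3, k4, k5, k6⟩ h
  obtain ⟨e0, e2, e8⟩ : P 0 = Q 0 ∧ P 2 = Q 2 ∧ P 8 = Q 8 := by
    simpa [CIP.coords] using h
  have e1 : P 1 = Q 1 := by rw [h1, k1, e0, e8]
  have e3 : P 3 = Q 3 := by rw [h2, k2, e2, e8]
  have e6 : P 6 = Q 6 := mul_left_cancel₀ (sub_ne_zero.mpr hCD) <| by
    linear_combination h6 - k6 - mC * (h5 - k5) - h3 + k3 + h4 - k4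
      - e1 + e3 + mC * e0 - mC * e2
  have e4 : P 4 = Q 4 := by linarith
  have e5 : P 5 = Q 5 := by rw [h3, k3, e4]
  have e7 : P 7 = Q 7 := by rw [h4, k4, e6]
  apply Subtype.ext
  funext i
  fin_cases i <;> assumption

theorem CIP.coords_surjective {mA mB mC mD bA : ℝ} (hCD : mC ≠ mD) :
    Function.Surjective (CIP.coords mA mB mC mD bA) := by
  rintro ⟨a, b, w⟩
  have hne : mC - mD ≠ 0 := sub_ne_zero.mpr hCD
  let t := mB * b + w - mA * a - bA * w
  let c := (t - mD * (b - a)) / (mC - mD)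
  let d := (t - mC * (b - a)) / (mC - mD)
  have hx : a + c = b + d := by
    simp only [c, d]
    field_simp
    ring
  have hy : mA * a + bA * w + mC * c = mB * b + w + mD * d := by
    simp only [c, d, t]
    field_simp
    ring
  exact ⟨⟨![a, mA * a + bA * w, b, mB * b + w, c, mC * c, d, mD * d, w],
    rfl, rfl, rfl, rfl, hx, hy⟩, rfl⟩

theorem CIP.coords_bijective {mA mB mC mD bA : ℝ} (hCD : mC ≠ mD) :
    Function.Bijective (CIP.coords mA mB mC mD bA) :=
  ⟨CIP.coords_injective hCD, CIP.coords_surjective hCD⟩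

theorem stmt_0 (mA mB mC mD bA : ℝ) (hCD : mC ≠ mD) :
    (∀ P ∈ CIP mA mB mC mD bA, ∀ Q ∈ CIP mA mB mC mD bA, P + Q ∈ CIP mA mB mC mD bA) ∧
    (∀ (c : ℝ), ∀ P ∈ CIP mA mB mC mD bA, c • P ∈ CIP mA mB mC mD bA) ∧
    (∃ S : Submodule ℝ (Fin 9 → ℝ),
        (S : Set (Fin 9 → ℝ)) = CIP mA mB mC mD bA ∧ Module.finrank ℝ S = 3) ∧
    Function.Bijective
      (fun P : CIP mA mB mC mD bA =>
        (((P : Fin 9 → ℝ) 0, (P : Fin 9 → ℝ) 2, (P : Fin 9 → ℝ) 8) : ℝ × ℝ × ℝ)) := by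
  refine ⟨fun P hP Q hQ => CIP.add_mem hP hQ, fun c P hP => CIP.smul_mem c hP,
    ⟨CIP.submodule mA mB mC mD bA, rfl, ?_⟩, CIP.coords_bijective hCD⟩
  rw [(LinearEquiv.ofBijective _ (CIP.coords_bijective hCD)).finrank_eq]
  simp
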